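/- arXiv:2602.15079 — 3 statements merged into one kernel-verified Lean document; each statement's English description precedes it below -/
import Mathlib

section
/- Let Ω be a finite probability space with weights w, let K ≥ 2, let h, h̃ : Ω → Fin K be random variables, let a ∈ Fin K, and let 0 < α < 1. Assume the biased model marginals P(h = a) = α and P(h = i) = (1 − α)/(K − 1) for every i ≠ a, and assume real numbers A, Ã satisfy the intermediate relation Ã = (1/K)(1 − 2A) · Σ_{j ∈ Fin K} P(h̃ = j ∧ h = j)/P(h = j) + (1 − A). Then Ã = ((1 − 2A)(K − 1))/((1 − α)K) · ( A* + ((1 − α)/(α(K − 1)) − 1) · P(h̃ = a ∧ h = a) ) + (1 − A), where A* := P(h̃ = h). Moreover, when α = 1/K this expression reduces to Ã = (1 − 2A)·A* + (1 − A). -/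
open Classical in
/-- Probability of an event `E` on a finite probability space with weights `w`. -/
noncomputable def prob {Ω : Type*} [Fintype Ω] (w : Ω → ℝ) (E : Ω → Prop) : ℝ :=
  ∑ ω, if E ω then w ω else 0

/-- The probability that `f` and `g` agree is the sum over all values of the probability that both
take that value. -/
theorem sum_prob_eq_and_eq {Ω β : Type*} [Fintype Ω] [Fintype β] (w : Ω → ℝ) (f g : Ω → β) :
    ∑ j, prob w (fun ω => f ω = j ∧ g ω = j) = prob w (fun ω => f ω = g ω) := by
  classical
  unfold prob
  rw [Finset.sum_comm]
  refine Finset.sum_congr rfl fun ω _ => ?_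
  rw [Finset.sum_eq_single (f ω)]
  · simp [eq_comm]
  · intro j _ hj
    exact if_neg fun hω => hj hω.1.symm
  · simp

/-- **Theorem 2 (biased classifier).** Assuming the biased model marginals and the
intermediate relation `Ã = (1/K)(1 − 2A)·Σⱼ P(h̃=j ∧ h=j)/P(h=j) + (1 − A)`, the
robustness accuracy satisfies
`Ã = ((1 − 2A)(K − 1))/((1 − α)K) · (A* + ((1 − α)/(α(K − 1)) − 1)·P(h̃=a ∧ h=a)) + (1 − A)`,
and this reduces to `Ã = (1 − 2A)A* + (1 − A)` when `α = 1/K`. -/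
theorem biased_classifier_robustness_accuracy
    {Ω : Type*} [Fintype Ω] (w : Ω → ℝ)
    (hw0 : ∀ ω, 0 ≤ w ω) (hw1 : ∑ ω, w ω = 1)
    (K : ℕ) (hK : 2 ≤ K)
    (h ht : Ω → Fin K) (a : Fin K) (α : ℝ) (hα0 : 0 < α) (hα1 : α < 1)
    (hbias : prob w (fun ω => h ω = a) = α)
    (hunbias : ∀ i : Fin K, i ≠ a →
      prob w (fun ω => h ω = i) = (1 - α) / ((K : ℝ) - 1))
    (A At : ℝ)
    (hint : At = (1 / (K : ℝ)) * (1 - 2 * A)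
        * (∑ j : Fin K,
            prob w (fun ω => ht ω = j ∧ h ω = j) / prob w (fun ω => h ω = j))
        + (1 - A)) :
    At = ((1 - 2 * A) * ((K : ℝ) - 1)) / ((1 - α) * (K : ℝ))
          * (prob w (fun ω => ht ω = h ω)
            + ((1 - α) / (α * ((K : ℝ) - 1)) - 1)
              * prob w (fun ω => ht ω = a ∧ h ω = a))
        + (1 - A)
      ∧ (α = 1 / (K : ℝ) →
          At = (1 - 2 * A) * prob w (fun ω => ht ω = h ω) + (1 - A)) := by
  have hK1 : (0 : ℝ) < (K : ℝ) - 1 := by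
    have : (2 : ℝ) ≤ K := by exact_mod_cast hK
    linarith
  have hK0 : (K : ℝ) ≠ 0 := by linarith
  have hα : 1 - α ≠ 0 := by linarith
  have hagree := sum_prob_eq_and_eq w ht h
  rw [← Finset.add_sum_erase _ _ (Finset.mem_univ a)] at hagree
  have hratio : ∑ j ∈ Finset.univ.erase a,
        prob w (fun ω => ht ω = j ∧ h ω = j) / prob w (fun ω => h ω = j)
      = (∑ j ∈ Finset.univ.erase a, prob w (fun ω => ht ω = j ∧ h ω = j))
        / ((1 - α) / ((K : ℝ) - 1)) := by
    rw [Finset.sum_div]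
    exact Finset.sum_congr rfl fun j hj => by rw [hunbias j (Finset.ne_of_mem_erase hj)]
  rw [← Finset.add_sum_erase _ _ (Finset.mem_univ a), hratio, hbias,
    eq_sub_of_add_eq' hagree] at hint
  have hbiased : At = ((1 - 2 * A) * ((K : ℝ) - 1)) / ((1 - α) * (K : ℝ))
        * (prob w (fun ω => ht ω = h ω)
          + ((1 - α) / (α * ((K : ℝ) - 1)) - 1)
            * prob w (fun ω => ht ω = a ∧ h ω = a))
      + (1 - A) := by
    rw [hint]
    field_simp
    ring
  refine ⟨hbiased, fun hαK => ?_⟩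
  have hcoeff : (1 - α) * (K : ℝ) = (K : ℝ) - 1 := by
    rw [hαK]
    field_simp
  have hcorr : (1 - α) / (α * ((K : ℝ) - 1)) = 1 := by
    have hdenom : α * ((K : ℝ) - 1) = 1 - α := by
      rw [hαK]
      field_simp
    rw [hdenom, div_self hα]
  rw [hbiased, hcorr, hcoeff, mul_div_cancel_right₀ _ hK1.ne']
  ring
end

section
/- Work with 2×2 complex matrices, let Π₁ = |0⟩⟨0| = diag(1,0), let X be the Pauli bit-flip matrix, let Σ⁺ and Σ⁻ be 2×2 density matrices, and let 0 ≤ p₁ < 1 and 0 ≤ p₂ ≤ 1. Define A_s := (1/2)·Re Tr(Π₁Σ⁺) + (1/2)·Re Tr((I − Π₁)Σ⁻); define Ã_s⁽¹⁾ as the same expression with Σ^± replaced by the depolarised states (1 − p₁)Σ^± + (p₁/2)I, and Ã_s⁽²⁾ as the same expression with Σ^± replaced by the bit-flipped states (1 − p₂)Σ^± + p₂·XΣ^±X. Then Ã_s⁽¹⁾ = (1 − p₁)A_s + p₁/2, Ã_s⁽²⁾ = (1 − 2p₂)A_s + p₂, and hence (1 − p₁)(Ã_s⁽²⁾ − p₂)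 = (1 − 2p₂)(Ã_s⁽¹⁾ − p₁/2); i.e. Ã_s⁽²⁾ is an affine function of Ã_s⁽¹⁾ with slope (1 − 2p₂)/(1 − p₁), which is negative (the two noises are incompatible) if and only if p₂ > 1/2. -/
open Matrix
open scoped ComplexOrder

section QubitMatrices

variable {R : Type*} [CommRing R] (M : Matrix (Fin 2) (Fin 2) R)

theorem trace_diag_one_zero_mul : (!![1, 0; 0, 0] * M).trace = M 0 0 := by
  rw [eta_fin_two M]
  simp [trace_fin_two]

theorem trace_one_sub_diag_one_zero_mul : ((1 - !![1, 0; 0, 0]) * M).trace = M 1 1 := by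
  rw [sub_mul, one_mul, trace_sub, trace_diag_one_zero_mul, trace_fin_two, add_sub_cancel_left]

theorem bitFlip_conj_apply_zero :
    (!![0, 1; 1, 0] * M * !![0, 1; 1, 0] : Matrix (Fin 2) (Fin 2) R) 0 0 = M 1 1 := by
  rw [eta_fin_two M]
  simp

theorem bitFlip_conj_apply_one :
    (!![0, 1; 1, 0] * M * !![0, 1; 1, 0] : Matrix (Fin 2) (Fin 2) R) 1 1 = M 0 0 := by
  rw [eta_fin_two M]
  simp

end QubitMatrices

/-- **Example 8 (incompatible noise).** For the measurement `Π₁ = |0⟩⟨0|` on a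
qubit, depolarisation noise with parameter `p₁` gives `Ã_s⁽¹⁾ = (1 − p₁)A_s + p₁/2`,
bit-flip noise with parameter `p₂` gives `Ã_s⁽²⁾ = (1 − 2p₂)A_s + p₂`, hence
`(1 − p₁)(Ã_s⁽²⁾ − p₂) = (1 − 2p₂)(Ã_s⁽¹⁾ − p₁/2)`, an affine relation whose slope
`(1 − 2p₂)/(1 − p₁)` is negative (the noises are incompatible) iff `p₂ > 1/2`. -/
theorem depolarisation_bitflip_incompatible
    (Sp Sm : Matrix (Fin 2) (Fin 2) ℂ)
    (hSp : Sp.PosSemidef) (hSptr : Sp.trace = 1)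
    (hSm : Sm.PosSemidef) (hSmtr : Sm.trace = 1)
    (X P1 : Matrix (Fin 2) (Fin 2) ℂ)
    (hX : X = !![0, 1; 1, 0])
    (hP1 : P1 = !![1, 0; 0, 0])
    (p1 p2 : ℝ) (hp1l : 0 ≤ p1) (hp1u : p1 < 1) (hp2l : 0 ≤ p2) (hp2u : p2 ≤ 1)
    (Sp1 Sm1 Sp2 Sm2 : Matrix (Fin 2) (Fin 2) ℂ)
    (hSp1 : Sp1 = ((1 - p1 : ℝ) : ℂ) • Sp
        + ((p1 / 2 : ℝ) : ℂ) • (1 : Matrix (Fin 2) (Fin 2) ℂ))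
    (hSm1 : Sm1 = ((1 - p1 : ℝ) : ℂ) • Sm
        + ((p1 / 2 : ℝ) : ℂ) • (1 : Matrix (Fin 2) (Fin 2) ℂ))
    (hSp2 : Sp2 = ((1 - p2 : ℝ) : ℂ) • Sp + ((p2 : ℝ) : ℂ) • (X * Sp * X))
    (hSm2 : Sm2 = ((1 - p2 : ℝ) : ℂ) • Sm + ((p2 : ℝ) : ℂ) • (X * Sm * X))
    (As Ats1 Ats2 : ℝ)
    (hAs : As = (1 / 2) * ((P1 * Sp).trace).re
        + (1 / 2) * (((1 - P1) * Sm).trace).re)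
    (hAts1 : Ats1 = (1 / 2) * ((P1 * Sp1).trace).re
        + (1 / 2) * (((1 - P1) * Sm1).trace).re)
    (hAts2 : Ats2 = (1 / 2) * ((P1 * Sp2).trace).re
        + (1 / 2) * (((1 - P1) * Sm2).trace).re) :
    Ats1 = (1 - p1) * As + p1 / 2
      ∧ Ats2 = (1 - 2 * p2) * As + p2
      ∧ (1 - p1) * (Ats2 - p2) = (1 - 2 * p2) * (Ats1 - p1 / 2)
      ∧ ((1 - 2 * p2) / (1 - p1) < 0 ↔ 1 / 2 < p2) := by
  have hp : (Sp 0 0).re + (Sp 1 1).re = 1 := by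
    simpa [trace_fin_two] using congrArg Complex.re hSptr
  have hm : (Sm 0 0).re + (Sm 1 1).re = 1 := by
    simpa [trace_fin_two] using congrArg Complex.re hSmtr
  subst hP1 hX hSp1 hSm1 hSp2 hSm2
  rw [trace_diag_one_zero_mul, trace_one_sub_diag_one_zero_mul] at hAs hAts1 hAts2
  simp only [Matrix.add_apply, Matrix.smul_apply, smul_eq_mul, Matrix.one_apply_eq, mul_one,
    bitFlip_conj_apply_zero, bitFlip_conj_apply_one, Complex.add_re, Complex.re_ofReal_mul,
    Complex.ofReal_re] at hAts1 hAts2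
  have h1 : Ats1 = (1 - p1) * As + p1 / 2 := by
    rw [hAts1, hAs]
    ring
  have h2 : Ats2 = (1 - 2 * p2) * As + p2 := by
    rw [hAts2, hAs]
    linear_combination (p2 / 2) * hp + (p2 / 2) * hm
  refine ⟨h1, h2, by rw [h1, h2]; ring, ?_⟩
  rw [div_lt_iff₀ (sub_pos.2 hp1u), zero_mul]
  constructor <;> intro h <;> linarith
end

section
/- Let σ and ρ be n×n density matrices and let Π be an n×n effect, and suppose the model assigns class +1 to a state ω when Re Tr(Πω) > 1/2. If Re Tr(Πσ) > 1/2 and the trace distance satisfies τ(σ, ρ) < Re Tr(Πσ) − 1/2, where τ(σ, ρ) := (1/2)·Σ_i |λ_i| with λ_1, …, λ_n the eigenvalues (with multiplicity) of the Hermitian matrix σ − ρ, then Re Tr(Πρ) > 1/2; i.e. the prediction does not change: any perturbation of σ that is smaller in trace distance than the margin p_σ − 1/2 leaves the class assignment of the binary quantum linear classifier invariant. -/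
open Matrix
open scoped ComplexOrder

/-- The trace of `P * A` in an eigenbasis of the Hermitian matrix `A`. -/
lemma trace_mul_eq_sum_diag_mul_eigenvalues {ι : Type*} [Fintype ι] [DecidableEq ι]
    {A : Matrix ι ι ℂ} (hA : A.IsHermitian) (P : Matrix ι ι ℂ) :
    (P * A).trace = ∑ i, ((hA.eigenvectorUnitary : Matrix ι ι ℂ)ᴴ * P *
      (hA.eigenvectorUnitary : Matrix ι ι ℂ)) i i * (hA.eigenvalues i : ℂ) := by
  conv_lhs => rw [hA.spectral_theorem, Unitary.conjStarAlgAut_apply, ← mul_assoc, trace_mul_comm,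
    ← mul_assoc, ← mul_assoc]
  simp [trace, mul_diagonal, star_eq_conjTranspose]

/-- The expectation of an effect in a Hermitian matrix is at most the sum of the
positive parts of the eigenvalues. -/
lemma re_trace_mul_le_half_sum_abs_eigenvalues {ι : Type*} [Fintype ι] [DecidableEq ι]
    {A P : Matrix ι ι ℂ} (hA : A.IsHermitian) (hP : P.PosSemidef) (hP' : (1 - P).PosSemidef) :
    (P * A).trace.re ≤ (1 / 2) * (∑ i, |hA.eigenvalues i| + A.trace.re) := by
  rw [trace_mul_eq_sum_diag_mul_eigenvalues hA, hA.trace_eq_sum_eigenvalues, Complex.re_sum,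
    Complex.re_sum, ← Finset.sum_add_distrib, Finset.mul_sum]
  refine Finset.sum_le_sum fun i _ => ?_
  set U : Matrix ι ι ℂ := (hA.eigenvectorUnitary : Matrix ι ι ℂ)
  have hU : Uᴴ * U = 1 := Unitary.coe_star_mul_self hA.eigenvectorUnitary
  have h0 : 0 ≤ ((Uᴴ * P * U) i i).re :=
    (Complex.le_def.1 ((hP.conjTranspose_mul_mul_same U).diag_nonneg (i := i))).1
  have h1 : ((Uᴴ * P * U) i i).re ≤ 1 := by
    have h := (Complex.le_def.1 ((hP'.conjTranspose_mul_mul_same U).diag_nonneg (i := i))).1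
    rw [mul_sub, sub_mul, mul_one, hU] at h
    simpa using h
  simp only [Complex.re_mul_ofReal, Complex.coe_algebraMap, Complex.ofReal_re]
  rcases abs_cases (hA.eigenvalues i) with ⟨h, h'⟩ | ⟨h, h'⟩ <;> simp [h] <;> nlinarith


/-- **Margin-based prediction-change robustness certificate.** For density
matrices `σ, ρ` and an effect `P`, if `Re Tr(Pσ) > 1/2` and the trace distance
`τ(σ, ρ) = (1/2)·Σᵢ |λᵢ(σ − ρ)|` is smaller than the margin `Re Tr(Pσ) − 1/2`,
then `Re Tr(Pρ) > 1/2`, i.e. the class assignment does not change. -/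
theorem margin_robustness_certificate
    {n : ℕ} (σ ρ P : Matrix (Fin n) (Fin n) ℂ)
    (hσ : σ.PosSemidef) (hσtr : σ.trace = 1)
    (hρ : ρ.PosSemidef) (hρtr : ρ.trace = 1)
    (hP : P.PosSemidef) (hPeff : (1 - P).PosSemidef)
    (hmargin : 1 / 2 < ((P * σ).trace).re)
    (hτ : (1 / 2) * ∑ i, |(hσ.isHermitian.sub hρ.isHermitian).eigenvalues i|
        < ((P * σ).trace).re - 1 / 2) :
    1 / 2 < ((P * ρ).trace).re := by
  have h := re_trace_mul_le_half_sum_abs_eigenvalues (hσ.isHermitian.sub hρ.isHermitian) hP hPeff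
  rw [mul_sub, trace_sub, trace_sub, hσtr, hρtr, sub_self, Complex.zero_re, Complex.sub_re] at h
  linarith
end
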